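/- Let n ≥ 2 be an integer and p a prime. Then there exist constants c₁, c₂, c₃, c₄ > 0 depending only on n and p such that for every real ν with 0 ≤ ν ≤ n−1 and all sufficiently large Q, the number of irreducible polynomials P ∈ ℤ[X] of degree n with c₁ Q ≤ H(P) ≤ c₂ Q and 0 < |D(P)|_p ≤ c₃ Q^{−2ν} is at least c₄ Q^{n+1 − ((n+2)/n) ν}. -/

import Mathlib

open Polynomial

/-- The height of an integer polynomial: the maximum of the absolute values of its
coefficients. -/
def polyHeight (P : Polynomial ℤ) : ℕ :=
  (Finset.range (P.natDegree + 1)).sup fun i => (P.coeff i).natAbs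

/-- `IsDiscriminant P D` asserts that `D ∈ ℤ` is the discriminant of the integer polynomial
`P` of degree `n = P.natDegree`, i.e. `D = a_n^{2n−2} ∏_{i<j} (α_i − α_j)²` where
`α_1, …, α_n` are the roots of `P` (with multiplicity) in an algebraic closure of `ℚ` and
`a_n` is the leading coefficient. -/
def IsDiscriminant (P : Polynomial ℤ) (D : ℤ) : Prop :=
  ∃ α : Fin P.natDegree → AlgebraicClosure ℚ,
    P.map (algebraMap ℤ (AlgebraicClosure ℚ)) =
      Polynomial.C (algebraMap ℤ (AlgebraicClosure ℚ) P.leadingCoeff) *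
        ∏ i : Fin P.natDegree, (Polynomial.X - Polynomial.C (α i)) ∧
    algebraMap ℤ (AlgebraicClosure ℚ) D =
      algebraMap ℤ (AlgebraicClosure ℚ) P.leadingCoeff ^ (2 * P.natDegree - 2) *
        ∏ q ∈ Finset.univ.filter
            (fun q : Fin P.natDegree × Fin P.natDegree => q.1 < q.2),
          (α q.1 - α q.2) ^ 2

/-- The value at `(u, v)` of the binary form of degree `n` with coefficients `g 0, …, g n`. -/
def binForm {R : Type*} [CommRing R] (g : ℕ → ℤ) (n : ℕ) (u v : R) : R :=
  ∑ i ∈ Finset.range (n + 1), (g i : R) * u ^ i * v ^ (n - i)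

section BinForm

variable {R S : Type*} [CommRing R] [CommRing S] (g : ℕ → ℤ) (n : ℕ)

lemma map_binForm (f : R →+* S) (u v : R) : f (binForm g n u v) = binForm g n (f u) (f v) := by
  simp [binForm]

lemma binForm_mul_mul (r u v : R) : binForm g n (r * u) (r * v) = r ^ n * binForm g n u v := by
  unfold binForm
  rw [Finset.mul_sum]
  refine Finset.sum_congr rfl fun i hi => ?_
  have h : r ^ n = r ^ i * r ^ (n - i) := by
    rw [← pow_add]; congr 1; have := Finset.mem_range.1 hi; omega
  rw [h, mul_pow, mul_pow]; ring

lemma binForm_zero_right (u : R) : binForm g n u 0 = g n * u ^ n := by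
  unfold binForm
  rw [Finset.sum_eq_single n]
  · simp
  · intro i hi hin
    have := Finset.mem_range.1 hi
    rw [zero_pow (by omega), mul_zero]
  · simp

lemma binForm_zero_left (v : R) : binForm g n 0 v = g 0 * v ^ n := by
  unfold binForm
  rw [Finset.sum_eq_single 0]
  · simp
  · intro i hi hin
    rw [zero_pow hin, mul_zero, zero_mul]
  · simp

lemma binForm_sub (g' : ℕ → ℤ) (u v : R) :
    binForm (g - g') n u v = binForm g n u v - binForm g' n u v := by
  simp [binForm, sub_mul, Finset.sum_sub_distrib]

end BinForm

/-- The polynomial obtained from a binary form by the substitution `(aX + b, cX + d)`. -/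
noncomputable def binPoly (g : ℕ → ℤ) (n : ℕ) (a b c d : ℤ) : ℤ[X] :=
  binForm g n (C a * X + C b) (C c * X + C d)

section BinPoly

variable (g : ℕ → ℤ) (n : ℕ) (a b c d : ℤ)

lemma eval_binPoly (s : ℤ) :
    (binPoly g n a b c d).eval s = binForm g n (a * s + b) (c * s + d) := by
  rw [binPoly, ← coe_evalRingHom, map_binForm]; simp

lemma coeff_zero_binPoly : (binPoly g n a b c d).coeff 0 = binForm g n b d := by
  rw [coeff_zero_eq_eval_zero, eval_binPoly]; simp

lemma natDegree_binPoly_le : (binPoly g n a b c d).natDegree ≤ n := by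
  unfold binPoly binForm
  refine natDegree_sum_le_of_forall_le (Finset.range (n + 1)) _ fun i hi => ?_
  have hi' := Finset.mem_range.1 hi
  have h1 : ((g i : ℤ) : ℤ[X]).natDegree ≤ 0 := (natDegree_intCast _).le
  have h2 : ((C a * X + C b) ^ i : ℤ[X]).natDegree ≤ i * 1 :=
    natDegree_pow_le_of_le _ natDegree_linear_le
  have h3 : ((C c * X + C d) ^ (n - i) : ℤ[X]).natDegree ≤ (n - i) * 1 :=
    natDegree_pow_le_of_le _ natDegree_linear_le
  have := natDegree_mul_le_of_le (natDegree_mul_le_of_le h1 h2) h3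
  omega

lemma coeff_binPoly_self : (binPoly g n a b c d).coeff n = binForm g n a c := by
  rw [binPoly, binForm, finsetSum_coeff, binForm]
  refine Finset.sum_congr rfl fun i hi => ?_
  have hi' := Finset.mem_range.1 hi
  have key : ∀ (x y : ℤ) (k : ℕ), ((C x * X + C y) ^ k : ℤ[X]).coeff k = x ^ k := by
    intro x y k
    have := coeff_pow_of_natDegree_le (m := k) (natDegree_linear_le (a := x) (b := y))
    rw [mul_one] at this
    rw [this, coeff_add, coeff_C_mul, coeff_X_one, coeff_C_succ, mul_one, add_zero]
  have h2 : ((C a * X + C b) ^ i : ℤ[X]).natDegree ≤ i := by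
    simpa using natDegree_pow_le_of_le i (natDegree_linear_le (a := a) (b := b))
  have h3 : ((C c * X + C d) ^ (n - i) : ℤ[X]).natDegree ≤ n - i := by
    simpa using natDegree_pow_le_of_le (n - i) (natDegree_linear_le (a := c) (b := d))
  have h4 := coeff_mul_add_eq_of_natDegree_le h2 h3
  rw [show i + (n - i) = n by omega, key, key] at h4
  rw [mul_assoc, ← C_eq_intCast, coeff_C_mul, h4, mul_assoc]

/-- Homogenised evaluation of `binPoly`. -/
lemma sum_coeff_binPoly (s r : ℤ) (hr : r ≠ 0) :
    ∑ j ∈ Finset.range (n + 1), (binPoly g n a b c d).coeff j * s ^ j * r ^ (n - j) =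
      binForm g n (a * s + b * r) (c * s + d * r) := by
  have hr' : (r : ℚ) ≠ 0 := by exact_mod_cast hr
  have h1 : ((binPoly g n a b c d).map (Int.castRingHom ℚ)).eval ((s : ℚ) / r) =
      binForm g n ((a : ℚ) * (s / r) + b) (c * (s / r) + d) := by
    rw [binPoly, ← coe_mapRingHom, map_binForm, ← coe_evalRingHom, map_binForm]; simp
  have h2 : (r : ℚ) ^ n * binForm g n ((a : ℚ) * (s / r) + b) (c * (s / r) + d) =
      binForm g n ((a : ℚ) * s + b * r) (c * s + d * r) := by
    rw [← binForm_mul_mul]; congr 1 <;> field_simp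
  have h3 : (r : ℚ) ^ n * ((binPoly g n a b c d).map (Int.castRingHom ℚ)).eval ((s : ℚ) / r) =
      ∑ j ∈ Finset.range (n + 1),
        ((binPoly g n a b c d).coeff j : ℚ) * s ^ j * r ^ (n - j) := by
    rw [eval_eq_sum_range' (n := n + 1), Finset.mul_sum]
    · refine Finset.sum_congr rfl fun j hj => ?_
      have hj' := Finset.mem_range.1 hj
      have : (r : ℚ) ^ n = r ^ j * r ^ (n - j) := by rw [← pow_add]; congr 1; omega
      rw [this, coeff_map, div_pow]
      field_simp; simp [mul_comm]
    · exact lt_of_le_of_lt natDegree_map_le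
        (Nat.lt_succ_of_le (natDegree_binPoly_le g n a b c d))
  have h4 := map_binForm g n (Int.castRingHom ℚ) (a * s + b * r) (c * s + d * r)
  rw [h1, h2] at h3
  simp only [eq_intCast, Int.cast_add, Int.cast_mul] at h4
  rw [← h4] at h3
  exact_mod_cast h3.symm

lemma dvd_binForm_of_C_dvd_binPoly {q : ℤ} (h : C q ∣ binPoly g n a b c d) (s r : ℤ)
    (hr : r ≠ 0) : q ∣ binForm g n (a * s + b * r) (c * s + d * r) := by
  rw [← sum_coeff_binPoly _ _ _ _ _ _ _ _ hr]
  rw [C_dvd_iff_dvd_coeff] at h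
  exact Finset.dvd_sum fun j _ => ((h j).mul_right _).mul_right _

/-- Substituting an affine polynomial which is congruent to a common root modulo `k`. -/
lemma binPoly_comp {m k a' c' : ℤ} (ha : a * m + b = k * a') (hc : c * m + d = k * c') :
    (binPoly g n a b c d).comp (C m + C k * X) = C (k ^ n) * binPoly g n a a' c c' := by
  rw [binPoly, ← coe_compRingHom_apply, map_binForm, C_pow, binPoly, ← binForm_mul_mul]
  congr 1 <;> simp only [coe_compRingHom_apply, add_comp, mul_comp, C_comp, X_comp]
  · rw [show b = k * a' - a * m by linarith]; simp; ring
  · rw [show d = k * c' - c * m by linarith]; simp; ring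

/-- A binary form is determined by the polynomial it yields. -/
lemma binPoly_injective {g' : ℕ → ℤ} (hc : c ≠ 0) (hdet : a * d - b * c ≠ 0)
    (h : binPoly g n a b c d = binPoly g' n a b c d) : ∀ i ≤ n, g i = g' i := by
  set f : ℤ[X] := ∑ i ∈ Finset.range (n + 1), C (g i - g' i) * X ^ i with hf
  have hfe : ∀ u : ℤ, f.eval u = binForm (g - g') n u 1 := by
    intro u; simp [hf, eval_finsetSum, binForm]
  have hz : ∀ u : ℤ, a - c * u ≠ 0 → f.eval u = 0 := by
    intro u hu
    have h1 := sum_coeff_binPoly g n a b c d (d * u - b) (a - c * u) hu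
    rw [h, sum_coeff_binPoly g' n a b c d (d * u - b) (a - c * u) hu] at h1
    have h2 : ∀ g : ℕ → ℤ, binForm g n (a * (d * u - b) + b * (a - c * u))
        (c * (d * u - b) + d * (a - c * u)) = (a * d - b * c) ^ n * binForm g n u 1 := by
      intro g
      rw [← binForm_mul_mul]; congr 1 <;> ring
    rw [h2, h2] at h1
    rw [hfe, binForm_sub, sub_eq_zero]
    exact (mul_left_cancel₀ (pow_ne_zero _ hdet) h1).symm
  have hf0 : f = 0 := by
    refine eq_zero_of_infinite_isRoot f
      (Set.Infinite.mono (s := Set.Ioi |a|) ?_ (Set.Ioi_infinite _))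
    intro u hu
    refine hz u fun h0 => ?_
    have hu' : |a| < u := hu
    have : |a| = |c| * |u| := by rw [← abs_mul]; congr 1; linarith
    have h1 : 1 ≤ |c| := Int.one_le_abs hc
    nlinarith [le_abs_self u, abs_nonneg u]
  intro i hi
  have := congrArg (fun P => P.coeff i) hf0
  simp only [hf, finsetSum_coeff, coeff_C_mul, coeff_X_pow, coeff_zero] at this
  rw [Finset.sum_eq_single i] at this
  · simpa [sub_eq_zero] using this
  · intro j _ hj; simp [hj.symm]
  · simp; omega

end BinPoly

section Discriminant

lemma prod_filter_lt_eq {M : Type*} [CommMonoid M] {n : ℕ} (f : Fin n → Fin n → M) :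
    ∏ q ∈ Finset.univ.filter (fun q : Fin n × Fin n => q.1 < q.2), f q.1 q.2 =
      ∏ i, ∏ j ∈ Finset.Ioi i, f i j := by
  rw [Finset.prod_filter, Fintype.prod_prod_type]
  refine Finset.prod_congr rfl fun i _ => ?_
  rw [← Finset.prod_filter]
  congr 1
  ext j; simp

lemma prod_sub_compl_eq {K : Type*} [CommRing K] {n : ℕ} (α : Fin n → K) :
    ∏ i, ∏ j ∈ {i}ᶜ, (α i - α j) = (-1) ^ (n * (n - 1) / 2) *
      ∏ q ∈ Finset.univ.filter (fun q : Fin n × Fin n => q.1 < q.2), (α q.1 - α q.2) ^ 2 := by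
  rw [← Finset.prod_prod_Ioi_mul_eq_prod_prod_off_diag (fun j i => α i - α j),
    prod_filter_lt_eq (fun i j => (α i - α j) ^ 2)]
  have h1 : ∀ i j, (α i - α j) * (α j - α i) = (-1) * (α i - α j) ^ 2 := by intros; ring
  simp_rw [h1, Finset.prod_mul_distrib]
  congr 1
  simp_rw [Finset.prod_const, Fin.card_Ioi]
  rw [Finset.prod_pow_eq_pow_sum, Fin.sum_univ_eq_sum_range (fun i => n - 1 - i),
    Finset.sum_range_reflect (fun i => i), Finset.sum_range_id]

lemma map_discr_eq {K : Type*} [Field K] [CharZero K] (φ : ℤ →+* K) {P : ℤ[X]} {n : ℕ}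
    (hn : P.natDegree = n) (hn0 : 0 < n) (α : Fin n → K)
    (hα : P.map φ = C (φ P.leadingCoeff) * ∏ i, (X - C (α i))) :
    φ P.discr = φ P.leadingCoeff ^ (2 * n - 2) *
      ∏ q ∈ Finset.univ.filter (fun q : Fin n × Fin n => q.1 < q.2), (α q.1 - α q.2) ^ 2 := by
  have hinj : Function.Injective φ := φ.injective_int
  have hP0 : P ≠ 0 := by rintro rfl; simp at hn; omega
  set l := φ P.leadingCoeff with hl
  have hl0 : l ≠ 0 := by rw [hl, Ne, map_eq_zero_iff _ hinj]; simpa using hP0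
  have hlc : (P.map φ).leadingCoeff = l := leadingCoeff_map_of_injective hinj P
  have hdeg : (P.map φ).natDegree = n := by
    rw [natDegree_map_eq_of_injective hinj, hn]
  have hsplit : (P.map φ).Splits := by
    rw [hα]
    exact (Splits.C _).mul (Splits.prod fun i _ => Splits.X_sub_C _)
  have hroots : (P.map φ).roots = Finset.univ.val.map α := by
    rw [hα, roots_C_mul _ hl0]
    exact roots_multiset_prod_X_sub_C (Finset.univ.val.map α) ▸ by
      rw [Multiset.map_map]; rfl
  have h1 := resultant_deriv (f := P) (natDegree_pos_iff_degree_pos.1 (hn ▸ hn0))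
  have h2 := resultant_eq_prod_eval (P.map φ)
    (derivative (P.map φ)) (n - 1)
    ((natDegree_derivative_le _).trans (by rw [hdeg])) hsplit
  rw [hdeg, derivative_map, resultant_map_map, ← hn, h1, hn, hlc, hroots, Multiset.map_map] at h2
  have h3 : ∀ i, (derivative (P.map φ)).eval (α i) =
      l * ∏ j ∈ {i}ᶜ, (α i - α j) := by
    intro i
    have := Lagrange.eval_nodal_derivative_eval_node_eq (v := α) (Finset.mem_univ i)
    rw [hα, derivative_C_mul, eval_mul, eval_C]
    rw [Lagrange.nodal, Lagrange.eval_nodal] at this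
    rw [this, Finset.compl_singleton]
  have h4 : (Multiset.map ((fun x => eval x (derivative P |>.map φ)) ∘ α)
      Finset.univ.val).prod = l ^ n * ∏ i, ∏ j ∈ {i}ᶜ, (α i - α j) := by
    change ∏ i, _ = _
    simp_rw [Function.comp, ← derivative_map, h3, Finset.prod_mul_distrib]
    simp
  rw [h4, prod_sub_compl_eq, map_mul, map_mul, map_pow, map_neg, map_one] at h2
  have h5 : ((-1 : K)) ^ (n * (n - 1) / 2) * l ≠ 0 :=
    mul_ne_zero (pow_ne_zero _ (by simp)) hl0
  refine mul_left_cancel₀ h5 (h2.trans ?_)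
  rw [show l ^ (n - 1) * (l ^ n * ((-1) ^ (n * (n - 1) / 2) *
    ∏ q ∈ Finset.univ.filter (fun q : Fin n × Fin n => q.1 < q.2), (α q.1 - α q.2) ^ 2)) =
    (l ^ (n - 1) * l ^ n) * ((-1) ^ (n * (n - 1) / 2) *
    ∏ q ∈ Finset.univ.filter (fun q : Fin n × Fin n => q.1 < q.2), (α q.1 - α q.2) ^ 2) by ring,
    ← pow_add, show n - 1 + n = (2 * n - 2) + 1 by omega, pow_succ]
  ring

lemma exists_roots {K : Type*} [Field K] [IsAlgClosed K] [CharZero K] (φ : ℤ →+* K)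
    {P : ℤ[X]} {n : ℕ} (hn : P.natDegree = n) : ∃ α : Fin n → K,
      P.map φ = C (φ P.leadingCoeff) * ∏ i, (X - C (α i)) := by
  have hinj : Function.Injective φ := φ.injective_int
  have hs := IsAlgClosed.splits (P.map φ)
  have hcard := hs.natDegree_eq_card_roots
  rw [natDegree_map_eq_of_injective hinj, hn] at hcard
  have h1 : (P.map φ).roots.toList.length = n := by simp [hcard]
  refine ⟨fun i => (P.map φ).roots.toList.get (i.cast h1.symm), ?_⟩
  conv_lhs => rw [hs.eq_prod_roots, leadingCoeff_map_of_injective hinj]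
  congr 1
  generalize (P.map φ).roots = s at *
  subst h1
  conv_lhs => rw [← Multiset.coe_toList s, Multiset.map_coe, Multiset.prod_coe]
  rw [← List.prod_ofFn]
  congr 1
  simpa using (List.ofFn_getElem_eq_map s.toList (fun a => (X - C a : K[X]))).symm

lemma IsDiscriminant.of_roots {P : ℤ[X]} {D : ℤ} {n : ℕ} (hn : P.natDegree = n)
    (α : Fin n → AlgebraicClosure ℚ)
    (hα : P.map (algebraMap ℤ (AlgebraicClosure ℚ)) =
      C (algebraMap ℤ (AlgebraicClosure ℚ) P.leadingCoeff) * ∏ i, (X - C (α i)))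
    (hD : algebraMap ℤ (AlgebraicClosure ℚ) D =
      algebraMap ℤ (AlgebraicClosure ℚ) P.leadingCoeff ^ (2 * n - 2) *
      ∏ q ∈ Finset.univ.filter (fun q : Fin n × Fin n => q.1 < q.2), (α q.1 - α q.2) ^ 2) :
    IsDiscriminant P D := by
  subst hn
  exact ⟨α, hα, hD⟩

/-- Discriminants under affine changes of variable. -/
lemma isDiscriminant_of_comp {F H : ℤ[X]} {n : ℕ} (hn0 : 0 < n) (hF : F.natDegree = n)
    (hH : H.natDegree = n) (hlc : H.leadingCoeff = F.leadingCoeff) {m k : ℤ} (hk : k ≠ 0)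
    (h : F.comp (C m + C k * X) = C (k ^ n) * H) :
    IsDiscriminant F (k ^ (n * (n - 1)) * H.discr) := by
  obtain ⟨γ, hγ⟩ := exists_roots (algebraMap ℤ (AlgebraicClosure ℚ)) hH
  have hdisc := map_discr_eq _ hH hn0 γ hγ
  refine IsDiscriminant.of_roots hF
    (fun i => algebraMap ℤ (AlgebraicClosure ℚ) m + algebraMap ℤ (AlgebraicClosure ℚ) k * γ i) ?_ ?_
  all_goals
    generalize algebraMap ℤ (AlgebraicClosure ℚ) = φ at *
  · have hk' : φ k ≠ 0 := by rwa [Ne, map_eq_zero_iff _ φ.injective_int]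
    have hCk : C (φ k) * C (φ k)⁻¹ = 1 := by rw [← C_mul, mul_inv_cancel₀ hk', C_1]
    have h1 := congrArg (fun P => (P.map φ).comp (C (φ k)⁻¹ * (X - C (φ m)))) h
    have hX : (C (φ m) + C (φ k) * X).comp (C (φ k)⁻¹ * (X - C (φ m))) = X := by
      simp only [add_comp, C_comp, mul_comp, X_comp]
      rw [← mul_assoc, hCk]; ring
    simp only [Polynomial.map_comp, Polynomial.map_add, Polynomial.map_mul, map_C, map_X,
      comp_assoc, hγ, hlc, hX, comp_X, mul_comp, C_comp, prod_comp] at h1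
    have h2 : ∀ i, (X - C (φ m + φ k * γ i)) =
        C (φ k) * ((X - C (γ i)).comp (C (φ k)⁻¹ * (X - C (φ m)))) := by
      intro i
      simp only [sub_comp, C_comp, X_comp]
      rw [mul_sub, ← mul_assoc, hCk, C_add, C_mul]; ring
    simp_rw [h1, h2, Finset.prod_mul_distrib, Finset.prod_const, Finset.card_univ, Fintype.card_fin]
    rw [map_pow, C_pow]
    ring
  · have h3 : ∀ q : Fin n × Fin n, ((φ m + φ k * γ q.1) - (φ m + φ k * γ q.2)) ^ 2 =
        φ k ^ 2 * (γ q.1 - γ q.2) ^ 2 := by intro q; ring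
    simp_rw [h3, Finset.prod_mul_distrib, Finset.prod_const]
    have h4 : 2 * ((Finset.univ.filter (fun q : Fin n × Fin n => q.1 < q.2)).card) =
        n * (n - 1) := by
      rw [Finset.card_filter, Fintype.sum_prod_type]
      have h5 : ∀ i : Fin n, (∑ j : Fin n, if i < j then 1 else 0) = n - 1 - (i : ℕ) := by
        intro i
        rw [← Finset.card_filter, ← Fin.card_Ioi]
        congr 1; ext j; simp
      simp_rw [h5]
      rw [Fin.sum_univ_eq_sum_range (fun i => n - 1 - i),
        Finset.sum_range_reflect (fun i => i), mul_comm, Finset.sum_range_id_mul_two]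
    rw [map_mul, hdisc, hlc, map_pow, ← pow_mul, h4]
    ring

/-- The discriminant of an irreducible polynomial does not vanish. -/
lemma IsDiscriminant.ne_zero {P : ℤ[X]} {D : ℤ} (hD : IsDiscriminant P D) (hP : Irreducible P)
    (hdeg : P.natDegree ≠ 0) : D ≠ 0 := by
  obtain ⟨α, hα, hD⟩ := hD
  rintro rfl
  have hinj : Function.Injective (algebraMap ℤ (AlgebraicClosure ℚ)) :=
    (algebraMap ℤ (AlgebraicClosure ℚ)).injective_int
  have hirr : Irreducible (P.map (Int.castRingHom ℚ)) :=
    (IsPrimitive.Int.irreducible_iff_irreducible_map_cast (hP.isPrimitive hdeg)).1 hP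
  have hsep : (P.map (algebraMap ℤ (AlgebraicClosure ℚ))).Separable := by
    have := hirr.separable.map (f := algebraMap ℚ (AlgebraicClosure ℚ))
    rw [map_map] at this
    convert! this
  have hl0 : algebraMap ℤ (AlgebraicClosure ℚ) P.leadingCoeff ≠ 0 := by
    rw [Ne, map_eq_zero_iff _ hinj]; simpa using hP.ne_zero
  have hinjα : Function.Injective α := by
    rw [hα] at hsep
    exact separable_prod_X_sub_C_iff.1 hsep.of_mul_right
  rw [map_zero, eq_comm, mul_eq_zero, Finset.prod_eq_zero_iff] at hD
  obtain h | ⟨q, hq, h⟩ := hD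
  · exact hl0 (eq_zero_of_pow_eq_zero h)
  · have := hinjα (sub_eq_zero.1 (eq_zero_of_pow_eq_zero h))
    exact (Finset.mem_filter.1 hq).2.ne this

end Discriminant

/-- Conditions on a binary form which make it an Eisenstein form at `ℓ` that is primitive and has
constant coefficient prime to `p`. -/
structure AdmissibleForm (p ℓ n : ℕ) (g : ℕ → ℤ) : Prop where
  not_dvd_zero : ¬ (p : ℤ) ∣ g 0
  dvd : ∀ i < n, (ℓ : ℤ) ∣ g i
  not_sq_dvd : ¬ (ℓ : ℤ) ^ 2 ∣ g 0
  not_dvd_top : ¬ (ℓ : ℤ) ∣ g n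
  coprime : IsCoprime (g 0) (g n)

/-- Conditions on a substitution of determinant `-p ^ t`. -/
structure AdmissibleSubst (p ℓ t : ℕ) (a b c d : ℤ) : Prop where
  dvd : (p : ℤ) ∣ a
  dvd_sub : (ℓ : ℤ) ∣ a - 1
  not_dvd : ¬ (p : ℤ) ∣ c
  det : b * c - a * d = (p : ℤ) ^ t

lemma AdmissibleSubst.ne_zero {p ℓ t : ℕ} {a b c d : ℤ}
    (hM : AdmissibleSubst p ℓ t a b c d) : c ≠ 0 := by
  rintro rfl; exact hM.not_dvd (dvd_zero _)

section Admissible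

variable {p ℓ n t : ℕ} [Fact p.Prime] {g : ℕ → ℤ} {a b c d : ℤ}

lemma AdmissibleSubst.isCoprime (hM : AdmissibleSubst p ℓ t a b c d) :
    IsCoprime c ((p : ℤ) ^ t) := by
  have hp : Prime (p : ℤ) := Nat.prime_iff_prime_int.1 Fact.out
  exact ((Prime.coprime_iff_not_dvd hp).2 hM.not_dvd).symm.pow_right

lemma not_dvd_coeff_binPoly (hg : AdmissibleForm p ℓ n g) (hM : AdmissibleSubst p ℓ t a b c d) :
    ¬ (p : ℤ) ∣ (binPoly g n a b c d).coeff n := by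
  have hp : Prime (p : ℤ) := Nat.prime_iff_prime_int.1 Fact.out
  rw [coeff_binPoly_self, ← CharP.intCast_eq_zero_iff (ZMod p) p]
  have h := map_binForm g n (Int.castRingHom (ZMod p)) a c
  rw [eq_intCast, eq_intCast, eq_intCast, (CharP.intCast_eq_zero_iff (ZMod p) p a).2 hM.dvd,
    binForm_zero_left] at h
  rw [h]
  have h1 := hg.not_dvd_zero
  have h2 := hM.not_dvd
  rw [← CharP.intCast_eq_zero_iff (ZMod p) p] at h1 h2
  exact mul_ne_zero h1 (pow_ne_zero _ h2)

lemma natDegree_binPoly (hg : AdmissibleForm p ℓ n g) (hM : AdmissibleSubst p ℓ t a b c d) :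
    (binPoly g n a b c d).natDegree = n :=
  natDegree_eq_of_le_of_coeff_ne_zero (natDegree_binPoly_le ..) fun h =>
    not_dvd_coeff_binPoly hg hM (h ▸ dvd_zero _)

lemma exists_isDiscriminant_binPoly (hn : 0 < n) (hg : AdmissibleForm p ℓ n g)
    (hM : AdmissibleSubst p ℓ t a b c d) :
    ∃ D, IsDiscriminant (binPoly g n a b c d) (((p : ℤ) ^ t) ^ (n * (n - 1)) * D) := by
  have hp : Prime (p : ℤ) := Nat.prime_iff_prime_int.1 Fact.out
  have hk : (p : ℤ) ^ t ≠ 0 := pow_ne_zero _ hp.ne_zero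
  have hco := hM.isCoprime
  obtain ⟨r, s, hrs⟩ := id hco
  have hc : c * (-(r * d)) + d = (p : ℤ) ^ t * (s * d) := by linear_combination (-d) * hrs
  obtain ⟨a', ha'⟩ : (p : ℤ) ^ t ∣ a * (-(r * d)) + b := by
    refine hco.symm.dvd_of_dvd_mul_left ⟨a * (s * d) + 1, ?_⟩
    linear_combination a * hc + hM.det
  have hcoeff : (binPoly g n a a' c (s * d)).coeff n = (binPoly g n a b c d).coeff n := by
    rw [coeff_binPoly_self, coeff_binPoly_self]
  have hdeg : (binPoly g n a a' c (s * d)).natDegree = n := by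
    refine natDegree_eq_of_le_of_coeff_ne_zero (natDegree_binPoly_le ..) fun h => ?_
    rw [hcoeff] at h
    exact not_dvd_coeff_binPoly hg hM (h ▸ dvd_zero _)
  exact ⟨_, isDiscriminant_of_comp hn (natDegree_binPoly hg hM) hdeg
    (by rw [leadingCoeff, leadingCoeff, hdeg, natDegree_binPoly hg hM, hcoeff]) hk
    (binPoly_comp g n a b c d ha' hc)⟩

lemma dvd_of_binPoly_eq (hn : 0 < n) {g' : ℕ → ℤ} {a' b' c' d' : ℤ} (hg : AdmissibleForm p ℓ n g)
    (hM : AdmissibleSubst p ℓ t a b c d)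
    (hM' : AdmissibleSubst p ℓ t a' b' c' d')
    (h : binPoly g n a b c d = binPoly g' n a' b' c' d') :
    (p : ℤ) ^ t ∣ n * (d * c' - d' * c) := by
  set φ := Int.castRingHom (ZMod (p ^ t)) with hφ
  have hzero : ∀ x : ℤ, φ x = 0 ↔ (p : ℤ) ^ t ∣ x := by
    intro x
    rw [hφ, eq_intCast, CharP.intCast_eq_zero_iff (ZMod (p ^ t)) (p ^ t)]; push_cast; rfl
  have key : ∀ {g : ℕ → ℤ} {a b c d : ℤ}, AdmissibleSubst p ℓ t a b c d →
      ∃ e : ZMod (p ^ t), φ c * e = φ d ∧ (binPoly g n a b c d).map φ =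
        C (φ ((binPoly g n a b c d).coeff n)) * (X + C e) ^ n := by
    intro g a b c d hM
    obtain ⟨r, s, hrs⟩ := hM.isCoprime
    have hφk : φ ((p : ℤ) ^ t) = 0 := (hzero _).2 dvd_rfl
    have hrc : φ c * φ r = 1 := by
      have := congrArg φ hrs
      rw [map_add, map_mul, map_mul, hφk, mul_zero, add_zero, map_one] at this
      rw [mul_comm, this]
    have hdet : φ b * φ c = φ a * φ d := by
      have := congrArg φ hM.det
      rw [hφk, map_sub, map_mul, map_mul] at this
      exact sub_eq_zero.1 this
    refine ⟨φ r * φ d, by rw [← mul_assoc, hrc, one_mul], ?_⟩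
    have hb : φ a * (φ r * φ d) = φ b := by linear_combination φ b * hrc - φ r * hdet
    have hd : φ c * (φ r * φ d) = φ d := by rw [← mul_assoc, hrc, one_mul]
    rw [coeff_binPoly_self, map_binForm, binPoly, ← coe_mapRingHom, map_binForm, map_binForm,
      mul_comm (binForm g n _ _) _, ← binForm_mul_mul]
    simp only [coe_mapRingHom, Polynomial.map_add, Polynomial.map_mul, map_C, map_X]
    congr 1
    · rw [← hb, C_mul]; ring
    · conv_lhs => rw [← hd, C_mul]
      ring
  obtain ⟨e, he, hF⟩ := key (g := g) hM
  obtain ⟨e', he', hF'⟩ := key (g := g') hM'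
  rw [← h, hF] at hF'
  have hcoeff := congrArg (fun P => P.coeff (n - 1)) hF'
  simp only [coeff_C_mul, coeff_X_add_C_pow] at hcoeff
  rw [show n - (n - 1) = 1 by omega, pow_one, pow_one] at hcoeff
  have hch : n.choose (n - 1) = n := by
    rw [← Nat.choose_symm (by omega), show n - (n - 1) = 1 by omega, Nat.choose_one_right]
  rw [hch] at hcoeff
  have hunit : IsUnit (φ ((binPoly g n a b c d).coeff n)) := by
    have hp : Prime (p : ℤ) := Nat.prime_iff_prime_int.1 Fact.out
    obtain ⟨r, s, hrs⟩ := ((Prime.coprime_iff_not_dvd hp).2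
      (not_dvd_coeff_binPoly hg hM)).symm.pow_right (n := t)
    refine IsUnit.of_mul_eq_one (φ r) ?_
    have := congrArg φ hrs
    rwa [map_add, map_mul, map_mul, (hzero _).2 dvd_rfl, mul_zero, add_zero, map_one,
      mul_comm] at this
  have h1 := hunit.mul_left_cancel hcoeff
  rw [← hzero, map_mul, map_sub, map_mul, map_mul, ← he, ← he', map_natCast]
  linear_combination φ c * φ c' * h1

variable [Fact ℓ.Prime]

lemma isPrimitive_binPoly (hg : AdmissibleForm p ℓ n g) (hM : AdmissibleSubst p ℓ t a b c d) :
    (binPoly g n a b c d).IsPrimitive := by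
  have hp : Prime (p : ℤ) := Nat.prime_iff_prime_int.1 Fact.out
  have hℓ : Prime (ℓ : ℤ) := Nat.prime_iff_prime_int.1 Fact.out
  intro r hr
  have ha : a ≠ 0 := by
    rintro rfl
    exact hℓ.not_isUnit (isUnit_of_dvd_unit hM.dvd_sub (by simp))
  have hrp : IsCoprime r (((p : ℤ) ^ t) ^ n) := by
    refine IsCoprime.pow_right (IsCoprime.pow_right ?_)
    refine ((Prime.coprime_iff_not_dvd hp).2 fun h => ?_).symm
    exact not_dvd_coeff_binPoly hg hM (h.trans ((C_dvd_iff_dvd_coeff _ _).1 hr n))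
  have h1 := dvd_binForm_of_C_dvd_binPoly g n a b c d hr (-d) c hM.ne_zero
  have h2 := dvd_binForm_of_C_dvd_binPoly g n a b c d hr b (-a) (neg_ne_zero.2 ha)
  rw [show c * -d + d * c = 0 by ring, show a * -d + b * c = (p : ℤ) ^ t by rw [← hM.det]; ring,
    binForm_zero_right] at h1
  rw [show a * b + b * -a = 0 by ring, show c * b + d * -a = (p : ℤ) ^ t by rw [← hM.det]; ring,
    binForm_zero_left] at h2
  exact hg.coprime.isUnit_of_dvd' (hrp.dvd_of_dvd_mul_right h2) (hrp.dvd_of_dvd_mul_right h1)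

lemma irreducible_binPoly (hn : 2 ≤ n) (hpℓ : p ≠ ℓ) (hg : AdmissibleForm p ℓ n g)
    (hM : AdmissibleSubst p ℓ t a b c d) : Irreducible (binPoly g n a b c d) := by
  have hp : Prime (p : ℤ) := Nat.prime_iff_prime_int.1 Fact.out
  have hℓ : Prime (ℓ : ℤ) := Nat.prime_iff_prime_int.1 Fact.out
  have hcast : ∀ x : ℤ, algebraMap ℤ (ZMod ℓ) x = 0 ↔ (ℓ : ℤ) ∣ x := by
    intro x; rw [← CharP.intCast_eq_zero_iff (ZMod ℓ) ℓ, eq_intCast]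
  have ha1 : algebraMap ℤ (ZMod ℓ) a = 1 := by
    rw [← sub_eq_zero, ← map_one (algebraMap ℤ (ZMod ℓ)), ← map_sub, hcast]; exact hM.dvd_sub
  have hform : ∀ {R : Type} [CommRing R] (f : ℤ →+* R) (u v : R),
      (∀ i < n, f (g i) = 0) → binForm g n u v = f (g n) * u ^ n := by
    intro R _ f u v hf
    unfold binForm
    rw [Finset.sum_range_succ, Finset.sum_eq_zero, Nat.sub_self, pow_zero, mul_one, zero_add,
      eq_intCast]
    intro i hi
    have := hf i (Finset.mem_range.1 hi)
    rw [eq_intCast] at this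
    rw [this, zero_mul, zero_mul]
  have hlead : algebraMap ℤ (ZMod ℓ) (binPoly g n a b c d).leadingCoeff =
      algebraMap ℤ (ZMod ℓ) (g n) := by
    rw [leadingCoeff, natDegree_binPoly hg hM, coeff_binPoly_self, map_binForm, ha1,
      hform (algebraMap ℤ (ZMod ℓ)) _ _ fun i hi => (hcast _).2 (hg.dvd i hi), one_pow, mul_one]
  refine generalizedEisenstein (K := ZMod ℓ) (q := X - C (-b)) (p := n) ?_ (monic_X_sub_C _)
    (isPrimitive_binPoly hg hM) (by rw [natDegree_binPoly hg hM]; omega) ?_ ?_ ?_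
  · rw [Polynomial.map_sub, map_X, map_C]; exact irreducible_X_sub_C _
  · rw [hlead, Ne, hcast]; exact hg.not_dvd_top
  · rw [hlead, binPoly, ← coe_mapRingHom, map_binForm,
      hform (C.comp (algebraMap ℤ (ZMod ℓ))) _ _ fun i hi => by
        rw [RingHom.comp_apply, (hcast _).2 (hg.dvd i hi), C_0]]
    simp only [coe_mapRingHom, Polynomial.map_add, Polynomial.map_mul, map_C,
      map_X, ha1, map_neg, RingHom.comp_apply, C_1, one_mul, sub_neg_eq_add]
  · have hker : RingHom.ker (algebraMap ℤ (ZMod ℓ)) ^ 2 = Ideal.span {(ℓ : ℤ) ^ 2} := by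
      rw [← Ideal.span_singleton_pow]; congr 1
      ext x; rw [RingHom.mem_ker, hcast, Ideal.mem_span_singleton]
    rw [modByMonic_X_sub_C_eq_C_eval, map_C, Ne, C_eq_zero, Ideal.Quotient.eq_zero_iff_mem, hker,
      Ideal.mem_span_singleton, eval_binPoly]
    obtain ⟨e, he⟩ := hM.dvd_sub
    intro h
    have hsplit : (ℓ : ℤ) ^ 2 ∣ binForm g n (a * -b + b) (c * -b + d) -
        g 0 * (c * -b + d) ^ n := by
      unfold binForm
      rw [Finset.sum_range_succ', pow_zero, Nat.sub_zero, mul_one, Int.cast_id,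
        add_sub_cancel_right]
      refine Finset.dvd_sum fun i hi => ?_
      have hab : (ℓ : ℤ) ∣ a * -b + b := ⟨-(e * b), by linear_combination -b * he⟩
      have hin : i + 1 ≤ n := Finset.mem_range.1 hi
      refine Dvd.dvd.mul_right ?_ _
      rcases hin.eq_or_lt with h1 | h1
      · refine Dvd.dvd.mul_left ?_ _
        exact (pow_dvd_pow_of_dvd hab 2).trans (pow_dvd_pow _ (by omega))
      · rw [sq]
        exact mul_dvd_mul (hg.dvd _ h1) (hab.trans (dvd_pow_self _ (by omega)))
    have h2 := (dvd_sub_right h).1 hsplit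
    have hv : ¬ (ℓ : ℤ) ∣ (c * -b + d) ^ n := by
      intro h3
      have h4 := hℓ.dvd_of_dvd_pow h3
      have h5 : (ℓ : ℤ) ∣ (p : ℤ) ^ t := by
        have : (p : ℤ) ^ t = -(c * -b + d) - d * (a - 1) := by rw [← hM.det]; ring
        rw [this]
        exact dvd_sub (h4.neg_right) (hM.dvd_sub.mul_left _)
      have h6 := hℓ.dvd_of_dvd_pow h5
      rw [Int.natCast_dvd_natCast, Nat.prime_dvd_prime_iff_eq Fact.out Fact.out] at h6
      exact hpℓ h6.symm
    have hco : IsCoprime ((ℓ : ℤ) ^ 2) ((c * -b + d) ^ n) :=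
      ((Prime.coprime_iff_not_dvd hℓ).2 hv).pow_left
    exact hg.not_sq_dvd (hco.dvd_of_dvd_mul_right h2)

end Admissible

lemma sum_inv_odd_sq_le (N : ℕ) :
    ∑ k ∈ Finset.range N, (1 / (2 * (k : ℝ) + 3)) ^ 2 ≤ 1 / 4 - 1 / (4 * ((N : ℝ) + 1)) := by
  induction N with
  | zero => norm_num
  | succ N ih =>
    rw [Finset.sum_range_succ]
    have h : (1 / (2 * (N : ℝ) + 3)) ^ 2 ≤
        1 / (4 * ((N : ℝ) + 1)) - 1 / (4 * ((N : ℝ) + 1 + 1)) := by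
      rw [div_sub_div _ _ (by positivity) (by positivity), div_pow,
        div_le_div_iff₀ (by positivity) (by positivity)]
      nlinarith
    push_cast
    linarith

/-- At most half of the pairs in `{1, …, N}²` are not coprime. -/
lemma two_mul_card_not_coprime_le (N : ℕ) :
    2 * ((Finset.Ioc 0 N ×ˢ Finset.Ioc 0 N).filter fun z => ¬ z.1.Coprime z.2).card ≤ N ^ 2 := by
  let S : ℕ → Finset (ℕ × ℕ) := fun q =>
    (Finset.Ioc 0 N).filter (q ∣ ·) ×ˢ (Finset.Ioc 0 N).filter (q ∣ ·)
  have hS : ∀ q, ((S q).card : ℝ) ≤ (N : ℝ) ^ 2 * (1 / (q : ℝ)) ^ 2 := by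
    intro q
    have h : (((N / q : ℕ) : ℝ)) ≤ N * (1 / q) := by
      rw [mul_one_div]; exact Nat.cast_div_le
    simp only [S, Finset.card_product, Nat.Ioc_filter_dvd_card_eq_div, Nat.cast_mul, ← mul_pow]
    rw [sq]
    gcongr
  have hsub : ((Finset.Ioc 0 N ×ˢ Finset.Ioc 0 N).filter fun z => ¬ z.1.Coprime z.2) ⊆
      S 2 ∪ (Finset.range N).biUnion fun k => S (2 * k + 3) := by
    rintro ⟨x, y⟩ h
    rw [Finset.mem_filter, Finset.mem_product] at h
    obtain ⟨⟨hx, hy⟩, hxy⟩ := h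
    obtain ⟨q, hq, hqx, hqy⟩ := Nat.Prime.not_coprime_iff_dvd.1 hxy
    have hmem : (x, y) ∈ S q :=
      Finset.mem_product.2 ⟨Finset.mem_filter.2 ⟨hx, hqx⟩, Finset.mem_filter.2 ⟨hy, hqy⟩⟩
    rcases hq.eq_two_or_odd' with rfl | ⟨k, hk⟩
    · exact Finset.mem_union_left _ hmem
    · refine Finset.mem_union_right _ (Finset.mem_biUnion.2 ⟨k - 1, ?_, ?_⟩)
      · have := Nat.le_of_dvd (Finset.mem_Ioc.1 hx).1 hqx
        have := (Finset.mem_Ioc.1 hx).2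
        have := hq.two_le
        rw [Finset.mem_range]
        omega
      · have := hq.two_le
        rwa [show 2 * (k - 1) + 3 = q by omega]
  have hcard := (Finset.card_le_card hsub).trans
    ((Finset.card_union_le _ _).trans (Nat.add_le_add_left Finset.card_biUnion_le _))
  have hcard' : (((Finset.Ioc 0 N ×ˢ Finset.Ioc 0 N).filter
      fun z => ¬ z.1.Coprime z.2).card : ℝ) ≤
      ((S 2).card : ℝ) + ∑ k ∈ Finset.range N, ((S (2 * k + 3)).card : ℝ) := by exact_mod_cast hcard
  have hsum : ∑ k ∈ Finset.range N, ((S (2 * k + 3)).card : ℝ) ≤ (N : ℝ) ^ 2 * (1 / 4) := by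
    calc _ ≤ ∑ k ∈ Finset.range N, (N : ℝ) ^ 2 * (1 / (2 * (k : ℝ) + 3)) ^ 2 :=
          Finset.sum_le_sum fun k _ => by simpa using hS (2 * k + 3)
      _ ≤ _ := by
          rw [← Finset.mul_sum]
          refine mul_le_mul_of_nonneg_left ((sum_inv_odd_sq_le N).trans ?_) (sq_nonneg _)
          rw [sub_le_self_iff]
          positivity
  have h2 := hS 2
  norm_num at h2
  have : (2 : ℝ) * (((Finset.Ioc 0 N ×ˢ Finset.Ioc 0 N).filter
      fun z => ¬ z.1.Coprime z.2).card : ℝ) ≤ (N : ℝ) ^ 2 := by linarith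
  exact_mod_cast this

/-- Coprime pairs in `{1, …, N}²` with large entries and restrictions at the primes `p`, `ℓ`. -/
def goodPairs (p ℓ N : ℕ) : Finset (ℕ × ℕ) :=
  (Finset.Ioc 0 N ×ˢ Finset.Ioc 0 N).filter fun z => z.1.Coprime z.2 ∧ ¬ p ∣ z.1 ∧ ¬ ℓ ∣ z.1 ∧
    ¬ ℓ ∣ z.2 ∧ N ≤ 32 * z.1 ∧ N ≤ 32 * z.2

lemma sq_le_card_goodPairs {p ℓ : ℕ} (hp : p ≠ 1) (hℓ : 32 ≤ ℓ) (N : ℕ) :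
    N ^ 2 ≤ 8 * (goodPairs p ℓ N).card := by
  let B := Finset.Ioc 0 N
  let A := (B ×ˢ B).filter fun z => z.1.Coprime z.2 ∧ ¬ p ∣ z.1
  have hC := Finset.card_filter_add_card_filter_not (s := B ×ˢ B) (fun z => z.1.Coprime z.2)
  have hBcard : B.card = N := by simp [B]
  rw [Finset.card_product, hBcard] at hC
  have hnot := two_mul_card_not_coprime_le N
  have hCA : ((B ×ˢ B).filter fun z => z.1.Coprime z.2).card ≤ A.card + A.card := by
    calc _ ≤ (A ∪ A.image Prod.swap).card := Finset.card_le_card ?_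
      _ ≤ A.card + (A.image Prod.swap).card := Finset.card_union_le _ _
      _ ≤ _ := Nat.add_le_add_left Finset.card_image_le _
    rintro ⟨x, y⟩ h
    rw [Finset.mem_filter, Finset.mem_product] at h
    obtain ⟨⟨hx, hy⟩, hxy⟩ := h
    by_cases hpx : p ∣ x
    · refine Finset.mem_union_right _ (Finset.mem_image.2 ⟨(y, x), ?_, rfl⟩)
      exact Finset.mem_filter.2 ⟨Finset.mem_product.2 ⟨hy, hx⟩, hxy.symm, fun hpy =>
        hp (Nat.dvd_one.1 (hxy ▸ Nat.dvd_gcd hpx hpy))⟩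
    · exact Finset.mem_union_left _
        (Finset.mem_filter.2 ⟨Finset.mem_product.2 ⟨hx, hy⟩, hxy, hpx⟩)
  let S := B.filter (ℓ ∣ ·)
  let U := B.filter (32 * · < N)
  have hS : S.card ≤ N / 32 := by
    rw [Nat.Ioc_filter_dvd_card_eq_div]; exact Nat.div_le_div_left hℓ (by norm_num)
  have hU : U.card ≤ N / 32 := by
    calc U.card ≤ (Finset.Ioc 0 (N / 32)).card := Finset.card_le_card fun x hx => by
          rw [Finset.mem_filter, Finset.mem_Ioc] at hx
          rw [Finset.mem_Ioc]
          omega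
      _ = N / 32 := by simp
  have hA : A ⊆ goodPairs p ℓ N ∪ ((S ×ˢ B ∪ B ×ˢ S) ∪ (U ×ˢ B ∪ B ×ˢ U)) := by
    rintro ⟨x, y⟩ h
    simp only [A, S, U, B, goodPairs, Finset.mem_union, Finset.mem_filter, Finset.mem_product]
      at h ⊢
    rw [← not_lt, ← not_lt]
    tauto
  have hcard := (Finset.card_le_card hA).trans ((Finset.card_union_le _ _).trans
    (Nat.add_le_add_left ((Finset.card_union_le _ _).trans
      (Nat.add_le_add (Finset.card_union_le _ _) (Finset.card_union_le _ _))) _))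
  simp only [Finset.card_product, hBcard] at hcard
  have h32 : 32 * (N / 32) ≤ N := Nat.mul_div_le _ _
  nlinarith [Nat.mul_le_mul_right N hS, Nat.mul_le_mul_right N hU, Nat.mul_le_mul_right N h32]

/-- Existence of a substitution of bounded size with prescribed bottom row. -/
lemma exists_admissibleSubst {p ℓ c d : ℕ} (hp : p.Prime) (hℓ : ℓ.Prime) (hpℓ : p ≠ ℓ)
    (t : ℕ) (hc : 0 < c) (hcd : c.Coprime d) (hpc : ¬ p ∣ c) (hℓc : ¬ ℓ ∣ c) :
    ∃ a b : ℕ, AdmissibleSubst p ℓ t a b c d ∧ a < p * ℓ * c ∧ b * c = a * d + p ^ t := by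
  have h1 : p.Coprime ℓ := (Nat.coprime_primes hp hℓ).2 hpℓ
  have h2 : p.Coprime c := (Nat.Prime.coprime_iff_not_dvd hp).2 hpc
  have h3 : ℓ.Coprime c := (Nat.Prime.coprime_iff_not_dvd hℓ).2 hℓc
  have : NeZero c := ⟨hc.ne'⟩
  let w : ZMod c := -(p : ZMod c) ^ t * (d : ZMod c)⁻¹
  let k := Nat.chineseRemainder h1 0 1
  let m := Nat.chineseRemainder (Nat.Coprime.mul_left h2 h3) k.1 w.val
  have hm1 : m.1 ≡ k.1 [MOD p * ℓ] := m.2.1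
  have hm2 : m.1 ≡ w.val [MOD c] := m.2.2
  have hmp : m.1 ≡ 0 [MOD p] := (hm1.of_mul_right ℓ).trans k.2.1
  have hmℓ : m.1 ≡ 1 [MOD ℓ] := (hm1.of_mul_left p).trans k.2.2
  have hdvd : c ∣ m.1 * d + p ^ t := by
    rw [← CharP.cast_eq_zero_iff (ZMod c) c]
    have h4 : ((m.1 : ℕ) : ZMod c) = w := by
      rw [(ZMod.natCast_eq_natCast_iff _ _ _).2 hm2, ZMod.natCast_zmod_val]
    have h5 : (d : ZMod c) * (d : ZMod c)⁻¹ = 1 := ZMod.coe_mul_inv_eq_one d hcd.symm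
    push_cast
    rw [h4]
    linear_combination (-(p : ZMod c) ^ t) * h5
  obtain ⟨b, hb⟩ := hdvd
  refine ⟨m.1, b, ⟨?_, ?_, ?_, ?_⟩, ?_, by rw [hb, mul_comm]⟩
  · exact_mod_cast (Nat.modEq_zero_iff_dvd).1 hmp
  · have := (Nat.modEq_iff_dvd.1 hmℓ.symm)
    exact_mod_cast this
  · exact_mod_cast hpc
  · have : ((m.1 * d + p ^ t : ℕ) : ℤ) = c * b := by exact_mod_cast hb
    push_cast at this
    linear_combination -this
  · exact Nat.chineseRemainder_lt_mul _ _ _ (mul_ne_zero hp.ne_zero hℓ.ne_zero) hc.ne'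

/-- The coefficients `ℓ x, ℓ z₀, …, ℓ z_{n-2}, y` of an Eisenstein form. -/
def formCoeff (n ℓ x y : ℕ) (z : Fin (n - 1) → ℕ) (i : ℕ) : ℕ :=
  if i = 0 then ℓ * x else if h : i - 1 < n - 1 then ℓ * z ⟨i - 1, h⟩ else y

lemma formCoeff_zero (n ℓ x y : ℕ) (z : Fin (n - 1) → ℕ) : formCoeff n ℓ x y z 0 = ℓ * x :=
  if_pos rfl

lemma formCoeff_self {n : ℕ} (hn : 0 < n) (ℓ x y : ℕ) (z : Fin (n - 1) → ℕ) :
    formCoeff n ℓ x y z n = y := by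
  rw [formCoeff, if_neg hn.ne', dif_neg (lt_irrefl _)]

lemma formCoeff_succ (n ℓ x y : ℕ) (z : Fin (n - 1) → ℕ) (i : Fin (n - 1)) :
    formCoeff n ℓ x y z (i + 1) = ℓ * z i := by
  simp [formCoeff]

lemma dvd_formCoeff {n ℓ x y i : ℕ} (z : Fin (n - 1) → ℕ) (hi : i < n) :
    ℓ ∣ formCoeff n ℓ x y z i := by
  rcases Nat.eq_zero_or_pos i with rfl | h
  · rw [formCoeff_zero]; exact dvd_mul_right _ _
  · rw [formCoeff, if_neg h.ne', dif_pos (by omega)]; exact dvd_mul_right _ _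

lemma formCoeff_le {n ℓ x y M : ℕ} {z : Fin (n - 1) → ℕ} (hℓ : 0 < ℓ) (hx : x ≤ M) (hy : y ≤ M)
    (hz : ∀ j, z j ≤ M) (i : ℕ) : formCoeff n ℓ x y z i ≤ ℓ * M := by
  unfold formCoeff
  split_ifs with h1 h2
  · exact Nat.mul_le_mul_left _ hx
  · exact Nat.mul_le_mul_left _ (hz _)
  · exact hy.trans (Nat.le_mul_of_pos_left _ hℓ)

lemma admissibleForm_formCoeff {n p ℓ x y : ℕ} (hn : 0 < n) (hp : p.Prime) (hℓ : ℓ.Prime)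
    (hpℓ : p ≠ ℓ) (hxy : x.Coprime y) (hpx : ¬ p ∣ x) (hℓx : ¬ ℓ ∣ x) (hℓy : ¬ ℓ ∣ y)
    (z : Fin (n - 1) → ℕ) : AdmissibleForm p ℓ n fun i => formCoeff n ℓ x y z i := by
  refine ⟨?_, fun i hi => Int.natCast_dvd_natCast.2 (dvd_formCoeff z hi), ?_, ?_, ?_⟩ <;>
    simp only [formCoeff_zero, formCoeff_self hn]
  · rw [Int.natCast_dvd_natCast, hp.dvd_mul, Nat.prime_dvd_prime_iff_eq hp hℓ]
    tauto
  · rw [sq]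
    exact_mod_cast fun h => hℓx (Nat.dvd_of_mul_dvd_mul_left hℓ.pos h)
  · exact_mod_cast hℓy
  · rw [Nat.isCoprime_iff_coprime]
    exact Nat.Coprime.mul_left ((Nat.Prime.coprime_iff_not_dvd hℓ).2 hℓy) hxy

lemma natAbs_coeff_le_polyHeight (P : ℤ[X]) (i : ℕ) : (P.coeff i).natAbs ≤ polyHeight P := by
  by_cases hi : i ≤ P.natDegree
  · exact Finset.le_sup (f := fun i => (P.coeff i).natAbs)
      (Finset.mem_range.2 (Nat.lt_succ_of_le hi))
  · rw [coeff_eq_zero_of_natDegree_lt (not_le.1 hi)]; exact Nat.zero_le _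

lemma polyHeight_le_eval_one {P : ℤ[X]} (hP : ∀ i, 0 ≤ P.coeff i) :
    (polyHeight P : ℤ) ≤ P.eval 1 := by
  have h1 : ∀ i, ((P.coeff i).natAbs : ℤ) = P.coeff i := fun i => Int.natAbs_of_nonneg (hP i)
  have h2 : P.eval 1 = ((∑ i ∈ Finset.range (P.natDegree + 1), (P.coeff i).natAbs : ℕ) : ℤ) := by
    push_cast
    rw [eval_eq_sum_range]
    exact Finset.sum_congr rfl fun i _ => by rw [one_pow, mul_one, abs_of_nonneg (hP i)]
  rw [h2, Nat.cast_le]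
  refine Finset.sup_le fun i hi => ?_
  exact Finset.single_le_sum (f := fun i => (P.coeff i).natAbs) (fun _ _ => Nat.zero_le _) hi

lemma finite_natDegree_eq_polyHeight_le (n H : ℕ) :
    {P : ℤ[X] | P.natDegree = n ∧ polyHeight P ≤ H}.Finite := by
  refine Set.Finite.of_finite_image (f := fun P (i : Fin (n + 1)) => P.coeff i) ?_ ?_
  · refine (Set.finite_Icc (fun _ : Fin (n + 1) => -(H : ℤ)) fun _ => (H : ℤ)).subset ?_
    rintro _ ⟨P, ⟨-, hP⟩, rfl⟩
    have h : ∀ i, |P.coeff i| ≤ H := fun i => by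
      rw [Int.abs_eq_natAbs]; exact_mod_cast (natAbs_coeff_le_polyHeight P i).trans hP
    exact ⟨fun i => (abs_le.1 (h i)).1, fun i => (abs_le.1 (h i)).2⟩
  · rintro P ⟨hP, -⟩ P' ⟨hP', -⟩ h
    ext i
    by_cases hi : i < n + 1
    · exact congrFun h ⟨i, hi⟩
    · rw [coeff_eq_zero_of_natDegree_lt (by omega), coeff_eq_zero_of_natDegree_lt (by omega)]

lemma coeff_binPoly_nonneg (g : ℕ → ℕ) (n a b c d i : ℕ) :
    0 ≤ (binPoly (fun i => g i) n a b c d).coeff i := by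
  have h : binPoly (fun i => g i) n a b c d = Polynomial.map (Nat.castRingHom ℤ)
      (∑ i ∈ Finset.range (n + 1),
        C (g i) * (C a * X + C b) ^ i * (C c * X + C d) ^ (n - i)) := by
    simp [binPoly, binForm, Polynomial.map_sum]
  rw [h, coeff_map]
  exact Nat.cast_nonneg _

lemma mul_pow_le_polyHeight_binPoly (g : ℕ → ℕ) (n a b c d : ℕ) :
    g n * b ^ n ≤ polyHeight (binPoly (fun i => g i) n a b c d) := by
  refine le_trans ?_ (natAbs_coeff_le_polyHeight _ 0)
  rw [coeff_zero_binPoly]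
  have h : binForm (fun i => (g i : ℤ)) n (b : ℤ) d =
      ((∑ i ∈ Finset.range (n + 1), g i * b ^ i * d ^ (n - i) : ℕ) : ℤ) := by
    simp [binForm]
  rw [h, Int.natAbs_natCast, Finset.sum_range_succ, Nat.sub_self, pow_zero, mul_one]
  exact Nat.le_add_left _ _

lemma polyHeight_binPoly_le {g : ℕ → ℕ} {n a b c d M U : ℕ} (hg : ∀ i, g i ≤ M) (hab : a + b ≤ U)
    (hcd : c + d ≤ U) :
    polyHeight (binPoly (fun i => g i) n a b c d) ≤ (n + 1) * (M * U ^ n) := by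
  have h0 := polyHeight_le_eval_one (coeff_binPoly_nonneg g n a b c d)
  have h : (binPoly (fun i => (g i : ℤ)) n a b c d).eval 1 =
      ((∑ i ∈ Finset.range (n + 1), g i * (a + b) ^ i * (c + d) ^ (n - i) : ℕ) : ℤ) := by
    rw [eval_binPoly]
    simp [binForm]
  rw [h, Nat.cast_le] at h0
  refine h0.trans ?_
  calc _ ≤ ∑ i ∈ Finset.range (n + 1), M * U ^ n := Finset.sum_le_sum fun i hi => ?_
    _ = _ := by simp
  rw [Finset.mem_range] at hi
  calc _ ≤ M * U ^ i * U ^ (n - i) := by gcongr; exact hg i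
    _ = M * U ^ n := by rw [mul_assoc, ← pow_add, Nat.add_sub_cancel' (by omega)]

/-- A lower bound for the number of polynomials in a set containing all the `binPoly`s that arise
from bounded forms and substitutions. -/
lemma card_mul_le_ncard {p ℓ n s N M : ℕ} [Fact p.Prime] [Fact ℓ.Prime] (hn : 2 ≤ n)
    (hpℓ : p ≠ ℓ) (hN : n * N ≤ p ^ s) {S : Set ℤ[X]} (hS : S.Finite)
    (h : ∀ (a b c d : ℕ) (g : ℕ → ℕ), (c, d) ∈ goodPairs p ℓ N → a < p * ℓ * c →
      b * c = a * d + p ^ (2 * s) → AdmissibleSubst p ℓ (2 * s) a b c d →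
      AdmissibleForm p ℓ n (fun i => g i) → M ≤ 32 * g n → (∀ i, g i ≤ ℓ * M) →
      binPoly (fun i => g i) n a b c d ∈ S) :
    (goodPairs p ℓ N).card * ((goodPairs p ℓ M).card * M ^ (n - 1)) ≤ S.ncard := by
  have hp : p.Prime := Fact.out
  have hℓ : ℓ.Prime := Fact.out
  have hsub : ∀ v : ℕ × ℕ, v ∈ goodPairs p ℓ N → ∃ w : ℕ × ℕ,
      AdmissibleSubst p ℓ (2 * s) w.1 w.2 v.1 v.2 ∧ w.1 < p * ℓ * v.1 ∧
        w.2 * v.1 = w.1 * v.2 + p ^ (2 * s) := by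
    rintro ⟨c, d⟩ hv
    simp only [goodPairs, Finset.mem_filter, Finset.mem_product, Finset.mem_Ioc] at hv
    obtain ⟨a, b, hab⟩ := exists_admissibleSubst hp hℓ hpℓ (2 * s) hv.1.1.1 hv.2.1 hv.2.2.1
      hv.2.2.2.1
    exact ⟨(a, b), hab⟩
  choose! w hw using hsub
  let box : Finset (Fin (n - 1) → ℕ) := Fintype.piFinset fun _ => Finset.Ioc 0 M
  let dom := goodPairs p ℓ N ×ˢ (goodPairs p ℓ M ×ˢ box)
  let f : (ℕ × ℕ) × ((ℕ × ℕ) × (Fin (n - 1) → ℕ)) → ℤ[X] := fun v =>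
    binPoly (fun i => formCoeff n ℓ v.2.1.1 v.2.1.2 v.2.2 i) n (w v.1).1 (w v.1).2 v.1.1 v.1.2
  have hform : ∀ {x y : ℕ} (z : Fin (n - 1) → ℕ), (x, y) ∈ goodPairs p ℓ M →
      AdmissibleForm p ℓ n fun i => formCoeff n ℓ x y z i := by
    intro x y z hxy
    simp only [goodPairs, Finset.mem_filter, Finset.mem_product, Finset.mem_Ioc] at hxy
    exact admissibleForm_formCoeff (by omega) hp hℓ hpℓ hxy.2.1 hxy.2.2.1 hxy.2.2.2.1
      hxy.2.2.2.2.1 z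
  have hcard : dom.card = (goodPairs p ℓ N).card * ((goodPairs p ℓ M).card * M ^ (n - 1)) := by
    simp [dom, box]
  rw [← hcard, ← Set.ncard_coe_finset]
  refine Set.ncard_le_ncard_of_injOn f ?_ ?_ hS
  · rintro ⟨⟨c, d⟩, ⟨x, y⟩, z⟩ hv
    simp only [dom, Finset.coe_product, Set.mem_prod, Finset.mem_coe] at hv
    obtain ⟨hcd, hxy, hz⟩ := hv
    have hw' := hw _ hcd
    refine h _ _ _ _ _ hcd hw'.2.1 hw'.2.2 hw'.1 (hform z hxy) ?_ ?_
    all_goals simp only [goodPairs, Finset.mem_filter, Finset.mem_product, Finset.mem_Ioc] at hxy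
    · rw [formCoeff_self (by omega)]; exact hxy.2.2.2.2.2.2
    · refine formCoeff_le hℓ.pos hxy.1.1.2 hxy.1.2.2 fun j => ?_
      exact (Finset.mem_Ioc.1 (Fintype.mem_piFinset.1 hz j)).2
  · rintro ⟨⟨c, d⟩, ⟨x, y⟩, z⟩ hv ⟨⟨c', d'⟩, ⟨x', y'⟩, z'⟩ hv' hF
    simp only [dom, Finset.coe_product, Set.mem_prod, Finset.mem_coe] at hv hv'
    obtain ⟨hcd, hxy, hz⟩ := hv
    obtain ⟨hcd', hxy', hz'⟩ := hv'
    have hM := (hw _ hcd).1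
    have hM' := (hw _ hcd').1
    have hdvd := dvd_of_binPoly_eq (by omega) (hform z hxy) hM hM' hF
    have hvw : c = c' ∧ d = d' := by
      simp only [goodPairs, Finset.mem_filter, Finset.mem_product, Finset.mem_Ioc] at hcd hcd'
      have h0 : (n : ℤ) * ((d : ℤ) * c' - d' * c) = 0 := by
        refine Int.eq_zero_of_abs_lt_dvd hdvd ?_
        have h1 : |(d : ℤ) * c' - d' * c| < (N : ℤ) ^ 2 := by
          have e1 : d * c' ≤ N * N := Nat.mul_le_mul hcd.1.2.2 hcd'.1.1.2
          have e2 : d' * c ≤ N * N := Nat.mul_le_mul hcd'.1.2.2 hcd.1.1.2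
          have e3 : 0 < d * c' := Nat.mul_pos hcd.1.2.1 hcd'.1.1.1
          have e4 : 0 < d' * c := Nat.mul_pos hcd'.1.2.1 hcd.1.1.1
          zify at e1 e2 e3 e4
          rw [abs_lt, sq]
          constructor <;> linarith
        have h2 : (n : ℤ) * N ≤ (p : ℤ) ^ s := by exact_mod_cast hN
        have h3 : (2 : ℤ) ≤ n := by exact_mod_cast hn
        rw [abs_mul, abs_of_nonneg (by positivity : (0 : ℤ) ≤ n), mul_comm 2 s, pow_mul]
        calc (n : ℤ) * |(d : ℤ) * c' - d' * c| < n * (N : ℤ) ^ 2 := by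
              exact mul_lt_mul_of_pos_left h1 (by linarith)
          _ ≤ (n * N : ℤ) ^ 2 := by nlinarith [sq_nonneg (N : ℤ)]
          _ ≤ _ := by gcongr
      have h1 : d * c' = d' * c := by
        have hn0 : (n : ℤ) ≠ 0 := by exact_mod_cast (by omega : n ≠ 0)
        have := sub_eq_zero.1 ((mul_eq_zero.1 h0).resolve_left hn0)
        exact_mod_cast this
      have hc : c = c' := Nat.dvd_antisymm
        (hcd.2.1.dvd_of_dvd_mul_left (h1 ▸ dvd_mul_left _ _))
        (hcd'.2.1.dvd_of_dvd_mul_left (h1 ▸ dvd_mul_left _ _))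
      subst hc
      exact ⟨rfl, Nat.eq_of_mul_eq_mul_right hcd.1.1.1 h1⟩
    obtain ⟨rfl, rfl⟩ := hvw
    have hdet : ((w (c, d)).1 : ℤ) * d - (w (c, d)).2 * c ≠ 0 := by
      have := hM.det
      have hp0 : (p : ℤ) ^ (2 * s) ≠ 0 := pow_ne_zero _ (by exact_mod_cast hp.ne_zero)
      intro h0
      apply hp0
      rw [← this]
      linear_combination -h0
    have hg := binPoly_injective _ n _ _ _ _ hM.ne_zero hdet hF
    have hg' : ∀ i ≤ n, formCoeff n ℓ x y z i = formCoeff n ℓ x' y' z' i := fun i hi => by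
      exact_mod_cast hg i hi
    have hx := hg' 0 (Nat.zero_le _)
    have hy := hg' n le_rfl
    rw [formCoeff_zero, formCoeff_zero] at hx
    rw [formCoeff_self (by omega), formCoeff_self (by omega)] at hy
    have hz : z = z' := funext fun j => by
      have := hg' (j + 1) (by omega)
      rw [formCoeff_succ, formCoeff_succ] at this
      exact Nat.eq_of_mul_eq_mul_left hℓ.pos this
    rw [Nat.eq_of_mul_eq_mul_left hℓ.pos hx, hy, hz]

/-- Polynomials of degree `n` and height of order `M p ^ (s n)` whose discriminant is divisible by
`p ^ (2 s n (n - 1))`. -/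
def largePowerDiscr (p ℓ n s M : ℕ) : Set ℤ[X] :=
  {P | Irreducible P ∧ P.natDegree = n ∧ M * (p ^ s) ^ n ≤ 32 * polyHeight P ∧
    polyHeight P ≤ (n + 1) * (ℓ * M * ((2 * (p * ℓ) + 64 * n + 2) * p ^ s) ^ n) ∧
    ∃ D : ℤ, D ≠ 0 ∧ IsDiscriminant P (((p : ℤ) ^ (2 * s)) ^ (n * (n - 1)) * D)}

lemma sq_mul_pow_le_ncard_largePowerDiscr {p ℓ n s N M : ℕ} [Fact p.Prime] [Fact ℓ.Prime]
    (hn : 2 ≤ n) (hpℓ : p ≠ ℓ) (hℓ : 32 ≤ ℓ) (hN : n * N ≤ p ^ s) (hN' : p ^ s ≤ 2 * n * N) :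
    N ^ 2 * M ^ (n + 1) ≤ 64 * (largePowerDiscr p ℓ n s M).ncard := by
  have hp : p.Prime := Fact.out
  have hfin : (largePowerDiscr p ℓ n s M).Finite :=
    (finite_natDegree_eq_polyHeight_le n
      ((n + 1) * (ℓ * M * ((2 * (p * ℓ) + 64 * n + 2) * p ^ s) ^ n))).subset
      fun P hP => ⟨hP.2.1, hP.2.2.2.1⟩
  have hcard := card_mul_le_ncard (ℓ := ℓ) (M := M) hn hpℓ hN hfin ?_
  · have h1 := sq_le_card_goodPairs hp.ne_one hℓ N
    have h2 := sq_le_card_goodPairs hp.ne_one hℓ M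
    calc N ^ 2 * M ^ (n + 1) = N ^ 2 * (M ^ 2 * M ^ (n - 1)) := by
          rw [← pow_add, show 2 + (n - 1) = n + 1 by omega]
      _ ≤ (8 * (goodPairs p ℓ N).card) * ((8 * (goodPairs p ℓ M).card) * M ^ (n - 1)) := by gcongr
      _ = 64 * ((goodPairs p ℓ N).card * ((goodPairs p ℓ M).card * M ^ (n - 1))) := by ring
      _ ≤ _ := by gcongr
  · intro a b c d g hcd ha hb hM hg hgn hgM
    simp only [goodPairs, Finset.mem_filter, Finset.mem_product, Finset.mem_Ioc] at hcd
    obtain ⟨⟨⟨hc0, hc⟩, -, hd⟩, -, -, -, -, hcN, -⟩ := hcd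
    set R := p ^ s with hR
    have hRR : p ^ (2 * s) = R * R := by rw [hR, ← pow_add, two_mul]
    have hNR : N ≤ R := (Nat.le_mul_of_pos_left N (by omega)).trans hN
    rw [hRR] at hb
    have hRb : R ≤ b := by
      refine Nat.le_of_mul_le_mul_right ?_ hc0
      rw [hb]
      exact (Nat.mul_le_mul_left R (hc.trans hNR)).trans (Nat.le_add_left _ _)
    have hRc : R ≤ 64 * n * c := by nlinarith
    have hbR : b ≤ (p * ℓ + 64 * n) * R := by
      refine Nat.le_of_mul_le_mul_right ?_ hc0
      rw [hb]
      calc a * d + R * R ≤ p * ℓ * c * R + 64 * n * c * R := by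
            gcongr
            exact hd.trans hNR
        _ = _ := by ring
    have haR : a ≤ p * ℓ * R := ha.le.trans (by gcongr; exact hc.trans hNR)
    have hirr := irreducible_binPoly hn hpℓ hg hM
    have hdeg := natDegree_binPoly hg hM
    refine ⟨hirr, hdeg, ?_, ?_, ?_⟩
    · calc M * R ^ n ≤ 32 * g n * b ^ n := by gcongr
        _ = 32 * (g n * b ^ n) := by ring
        _ ≤ _ := by gcongr; exact mul_pow_le_polyHeight_binPoly g n a b c d
    · refine polyHeight_binPoly_le hgM ?_ ?_
      · nlinarith
      · have h1 : c + d ≤ 2 * R := by omega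
        refine h1.trans (Nat.mul_le_mul_right R (by omega))
    · obtain ⟨D, hD⟩ := exists_isDiscriminant_binPoly (by omega) hg hM
      exact ⟨D, right_ne_zero_of_mul (hD.ne_zero hirr (by omega)), hD⟩

/-- The choice of scale: a power `R` of `p` comparable to `Q ^ (ν / (n (n - 1)))`. -/
lemma exists_scale {p n : ℕ} (hp : 1 < p) (hn : 2 ≤ n) {ν Q : ℝ} (hν : 0 ≤ ν)
    (hν' : ν ≤ (n : ℝ) - 1) (hQ : ((p : ℝ) * n) ^ n ≤ Q) :
    ∃ (u : ℝ) (s : ℕ), 0 < u ∧ (∀ m : ℕ, Q ^ (ν / (n * (n - 1)) * m) = u ^ m) ∧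
      u ≤ p * (p : ℝ) ^ s ∧ (p : ℝ) ^ s ≤ p * n * u ∧ n ≤ p ^ s ∧ ((p : ℝ) ^ s) ^ n ≤ Q := by
  have hp1 : (1 : ℝ) < p := by exact_mod_cast hp
  have hn2 : (2 : ℝ) ≤ n := by exact_mod_cast hn
  have hpn : (1 : ℝ) ≤ p * n := by nlinarith
  have hQ1 : 1 ≤ Q := (one_le_pow₀ hpn).trans hQ
  have hQ0 : 0 < Q := by linarith
  have hden : 0 < (n : ℝ) * (n - 1) := by nlinarith
  set u := Q ^ (ν / (n * (n - 1))) with hu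
  have hpow : ∀ m : ℕ, Q ^ (ν / (n * (n - 1)) * m) = u ^ m := fun m => by
    rw [hu, Real.rpow_mul hQ0.le, Real.rpow_natCast]
  have hu1 : 1 ≤ u := Real.one_le_rpow hQ1 (by positivity)
  have hun : u ^ n ≤ Q := by
    rw [← hpow]
    conv_rhs => rw [← Real.rpow_one Q]
    refine Real.rpow_le_rpow_of_exponent_le hQ1 ?_
    rw [div_mul_eq_mul_div, div_le_one hden]
    nlinarith
  obtain ⟨s, hs, hs'⟩ := exists_nat_pow_near (le_max_of_le_left hu1 : 1 ≤ max u (p * n)) hp1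
  rw [pow_succ'] at hs'
  refine ⟨u, s, by linarith, hpow, (le_max_left _ _).trans hs'.le, hs.trans (max_le ?_ ?_), ?_,
    (pow_le_pow_left₀ (by positivity) hs n).trans ?_⟩
  · nlinarith
  · nlinarith
  · have := (le_max_right u ((p : ℝ) * n)).trans hs'.le
    have := le_of_mul_le_mul_left this (by linarith)
    exact_mod_cast this
  · rcases max_cases u ((p : ℝ) * n) with ⟨h, -⟩ | ⟨h, -⟩ <;> rw [h] <;> assumption

/-- Let `n ≥ 2` and `p` a prime. There are constants `c₁, c₂, c₃, c₄ > 0`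
depending only on `n` and `p` such that for every `0 ≤ ν ≤ n−1` and all sufficiently large
`Q`, the number of irreducible `P ∈ ℤ[X]` of degree `n` with `c₁ Q ≤ H(P) ≤ c₂ Q` and
`0 < |D(P)|_p ≤ c₃ Q^{−2ν}` is at least `c₄ Q^{n+1−((n+2)/n)ν}`. -/
theorem stmt4 (p : ℕ) [Fact p.Prime] (n : ℕ) (hn : 2 ≤ n) :
    ∃ c₁ c₂ c₃ c₄ : ℝ, 0 < c₁ ∧ 0 < c₂ ∧ 0 < c₃ ∧ 0 < c₄ ∧
      ∀ ν : ℝ, 0 ≤ ν → ν ≤ (n : ℝ) - 1 →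
      ∃ Q₀ : ℝ, ∀ Q : ℝ, Q₀ ≤ Q →
        c₄ * Q ^ ((n : ℝ) + 1 - ((n : ℝ) + 2) / (n : ℝ) * ν) ≤
          (({P : Polynomial ℤ | Irreducible P ∧ P.natDegree = n ∧
              c₁ * Q ≤ (polyHeight P : ℝ) ∧ (polyHeight P : ℝ) ≤ c₂ * Q ∧
              ∃ D : ℤ, IsDiscriminant P D ∧
                0 < ‖(D : ℚ_[p])‖ ∧ ‖(D : ℚ_[p])‖ ≤ c₃ * Q ^ (-(2 * ν))}).ncard : ℝ) := by
  have hp : p.Prime := Fact.out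
  obtain ⟨ℓ, hℓge, hℓ⟩ := Nat.exists_infinite_primes (p + 32)
  have : Fact ℓ.Prime := ⟨hℓ⟩
  have hpR : (0 : ℝ) < p := by exact_mod_cast hp.pos
  have hnR : (2 : ℝ) ≤ n := by exact_mod_cast hn
  have hℓR : (0 : ℝ) < ℓ := by exact_mod_cast hℓ.pos
  have hnn : n * (n + 1) = 2 + (n + 2) * (n - 1) := by
    obtain ⟨k, rfl⟩ : ∃ k, n = k + 1 := ⟨n - 1, by omega⟩
    simp only [Nat.add_sub_cancel]; ring
  have hcast : ((n - 1 : ℕ) : ℝ) = n - 1 := by push_cast [Nat.cast_sub (by omega : 1 ≤ n)]; ring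
  set m := (n + 2) * (n - 1) with hm
  refine ⟨1 / 64, (n + 1) * ℓ * (2 * (p * ℓ) + 64 * n + 2) ^ n, p ^ (2 * (n * (n - 1))),
    1 / (64 * (2 * n) ^ 2 * 2 ^ (n + 1) * (p * n) ^ m), by norm_num, by positivity, by positivity,
    by positivity, fun ν hν hν' => ⟨(p * n) ^ n, fun Q hQ => ?_⟩⟩
  obtain ⟨u, s, hu, hpow, huR, hRu, hnR', hRQ⟩ := exists_scale hp.one_lt hn hν hν' hQ
  have hQ0 : 0 < Q := (by positivity : (0 : ℝ) < (p * n) ^ n).trans_le hQ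
  have hn1 : (n : ℝ) - 1 ≠ 0 := by linarith
  set R : ℝ := (p : ℝ) ^ s with hR
  have hR0 : 0 < R := by positivity
  let N := p ^ s / n
  have hN1 : 0 < N := Nat.div_pos hnR' (by omega)
  have hN : n * N ≤ p ^ s := Nat.mul_div_le _ _
  have hN' : p ^ s ≤ 2 * n * N := by
    have h1 : p ^ s < n * (N + 1) := Nat.lt_mul_div_succ _ (by omega)
    nlinarith
  let M := ⌊Q / R ^ n⌋₊
  have hM : (M : ℝ) * R ^ n ≤ Q := by
    rw [← le_div_iff₀ (by positivity)]; exact Nat.floor_le (by positivity)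
  have hM' : Q ≤ 2 * M * R ^ n := by
    have h1 : (1 : ℝ) ≤ Q / R ^ n := by rwa [one_le_div₀ (by positivity)]
    have h2 : (1 : ℝ) ≤ M := by exact_mod_cast Nat.one_le_floor_iff _ |>.2 h1
    have h3 : Q / R ^ n < M + 1 := Nat.lt_floor_add_one _
    rw [← div_le_iff₀ (by positivity)]
    linarith
  have hcount := sq_mul_pow_le_ncard_largePowerDiscr (M := M) hn (by omega : p ≠ ℓ) (by omega)
    hN hN'
  have hcount' : (N : ℝ) ^ 2 * (M : ℝ) ^ (n + 1) ≤
      64 * ((largePowerDiscr p ℓ n s M).ncard : ℝ) := by exact_mod_cast hcount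
  have hfinal : 1 / (64 * (2 * n) ^ 2 * 2 ^ (n + 1) * (p * n) ^ m) *
      Q ^ ((n : ℝ) + 1 - ((n : ℝ) + 2) / (n : ℝ) * ν) ≤
      ((largePowerDiscr p ℓ n s M).ncard : ℝ) := by
    have hexp : Q ^ ((n : ℝ) + 1 - ((n : ℝ) + 2) / (n : ℝ) * ν) = Q ^ (n + 1) / u ^ m := by
      rw [← hpow, Real.rpow_sub hQ0, ← Real.rpow_natCast Q (n + 1)]
      congr 2
      · push_cast; ring
      · rw [hm]; push_cast; rw [hcast]; field_simp
    have hNR : R / (2 * n) ≤ N := by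
      rw [div_le_iff₀ (by positivity), hR, mul_comm]; exact_mod_cast hN'
    have hMR : Q / (2 * R ^ n) ≤ M := by
      rw [div_le_iff₀ (by positivity)]; linarith
    have hRm : R ^ m ≤ (p * n) ^ m * u ^ m := by
      rw [← mul_pow]; exact pow_le_pow_left₀ hR0.le hRu m
    have hRn : (R ^ n) ^ (n + 1) = R ^ 2 * R ^ m := by rw [← pow_mul, hnn, pow_add]
    calc _ = Q ^ (n + 1) / (64 * (2 * n) ^ 2 * 2 ^ (n + 1) * ((p * n) ^ m * u ^ m)) := by
          rw [hexp]; field_simp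
      _ ≤ Q ^ (n + 1) / (64 * (2 * n) ^ 2 * 2 ^ (n + 1) * R ^ m) := by gcongr
      _ = (R / (2 * n)) ^ 2 * (Q / (2 * R ^ n)) ^ (n + 1) / 64 := by
          rw [div_pow, div_pow, mul_pow 2 (R ^ n), hRn]
          field_simp
      _ ≤ (N : ℝ) ^ 2 * (M : ℝ) ^ (n + 1) / 64 := by gcongr
      _ ≤ _ := by linarith
  refine hfinal.trans (Nat.cast_le.2 (Set.ncard_le_ncard ?_ ?_))
  · rintro P ⟨hirr, hdeg, hlow, hup, D, hD0, hD⟩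
    have hlow' : (M : ℝ) * R ^ n ≤ 32 * polyHeight P := by rw [hR]; exact_mod_cast hlow
    have hup' : (polyHeight P : ℝ) ≤
        (n + 1) * (ℓ * M * ((2 * (p * ℓ) + 64 * n + 2) * R) ^ n) := by
      rw [hR]; exact_mod_cast hup
    refine ⟨hirr, hdeg, by linarith, hup'.trans ?_, _, hD, ?_, ?_⟩
    · calc _ = (n + 1) * ℓ * (2 * (p * ℓ) + 64 * n + 2) ^ n * ((M : ℝ) * R ^ n) := by
            rw [mul_pow]; ring
        _ ≤ _ := by gcongr
    · rw [norm_pos_iff, Int.cast_ne_zero]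
      exact mul_ne_zero (pow_ne_zero _ (pow_ne_zero _ (by exact_mod_cast hp.ne_zero))) hD0
    · have hQu : Q ^ (-(2 * ν)) = (u ^ (2 * (n * (n - 1))))⁻¹ := by
        rw [← hpow, Real.rpow_neg hQ0.le]
        congr 2
        push_cast; rw [hcast]; field_simp
      have hnorm : ‖(((((p : ℤ) ^ (2 * s)) ^ (n * (n - 1)) * D : ℤ)) : ℚ_[p])‖ ≤
          (R ^ (2 * (n * (n - 1))))⁻¹ := by
        push_cast
        rw [norm_mul, norm_pow, norm_pow, Padic.norm_p, inv_pow, inv_pow, hR, ← pow_mul,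
          ← pow_mul, show s * (2 * (n * (n - 1))) = 2 * s * (n * (n - 1)) by ring]
        exact mul_le_of_le_one_right (by positivity) (Padic.norm_int_le_one D)
      refine hnorm.trans ?_
      rw [hQu, ← div_eq_mul_inv, inv_le_iff_one_le_mul₀ (by positivity), div_mul_eq_mul_div,
        one_le_div₀ (by positivity), ← mul_pow]
      exact pow_le_pow_left₀ hu.le huR _
  · exact (finite_natDegree_eq_polyHeight_le n
      ⌊((n + 1) * ℓ * (2 * (p * ℓ) + 64 * n + 2) ^ n : ℝ) * Q⌋₊).subset
      fun P hP => ⟨hP.2.1, Nat.le_floor hP.2.2.2.1⟩
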